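/- Let E be an extended multi-segment datum whose order satisfies (P′), let k be a row label and t ∈ ℤ, and suppose that sh_k^t(E) is a symbol all of whose admissible reorderings satisfy (P′). Then dual(sh_k^t(E)) = add_k^t(dual(E)). (Lemma 3.13(ii) of the paper.) -/

import Mathlib

/-!
Common combinatorial setting for extended multi-segments (Moeglin-Atobe theory),
following Hazeltine-Liu-Lo, "On the intersection of local Arthur packets".
Rows of symbols are 0-indexed; row labels of labeled symbols are natural numbers.
-/

namespace LocalArthur

/-- A row `([A,B], l, eta)` of a symbol (an extended segment with the bound on `l` dropped). -/
structure Row where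
  A : ℚ
  B : ℚ
  l : ℚ
  eta : ℤ
deriving DecidableEq

/-- `a = A + B + 1`. -/
def Row.a (r : Row) : ℚ := r.A + r.B + 1

/-- `b = A - B + 1`. -/
def Row.b (r : Row) : ℚ := r.A - r.B + 1

/-- A rational number is an integer. -/
def IsInt (x : ℚ) : Prop := x.den = 1

instance (x : ℚ) : Decidable (IsInt x) := by unfold IsInt; infer_instance

/-- `(-1)^x` for an integer-valued rational `x` (junk value on non-integers). -/
def m1pow (x : ℚ) : ℤ := if x.num % 2 = 0 then 1 else -1

/-- Validity of a single row: `2A, 2B ∈ ℤ`, `A - B ∈ ℕ`, `l ∈ ℤ`, `eta = ±1`. -/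
def Row.IsES (r : Row) : Prop :=
  IsInt (2 * r.A) ∧ IsInt (2 * r.B) ∧ (∃ n : ℕ, r.A - r.B = (n : ℚ)) ∧
    IsInt r.l ∧ (r.eta = 1 ∨ r.eta = -1)

/-- The segment `[A,B]` of `r` is contained in that of `s`. -/
def Row.subseg (r s : Row) : Prop := s.B ≤ r.B ∧ r.A ≤ s.A

instance (r s : Row) : Decidable (r.subseg s) := by unfold Row.subseg; infer_instance

/-- A symbol: valid rows, `A_i + B_i ≥ 0`, all `A_i` congruent mod `ℤ`, and the
listed order admissible, i.e. condition (P). -/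
def IsSymbol (E : List Row) : Prop :=
  (∀ r ∈ E, r.IsES) ∧ (∀ r ∈ E, 0 ≤ r.A + r.B) ∧
    (∀ r ∈ E, ∀ s ∈ E, IsInt (r.A - s.A)) ∧
    E.Pairwise (fun r s => ¬ (s.A < r.A ∧ s.B < r.B))

/-- An extended multi-segment datum: a symbol with `0 ≤ l_i ≤ b_i / 2`. -/
def IsEMS (E : List Row) : Prop :=
  IsSymbol E ∧ ∀ r ∈ E, 0 ≤ r.l ∧ r.l ≤ r.b / 2

/-- The listed order satisfies (P'). -/
def Pprime (E : List Row) : Prop := E.Pairwise (fun r s => r.B ≤ s.B)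

/-- Equivalence of extended segments. -/
def Row.Equiv (r s : Row) : Prop :=
  r.A = s.A ∧ r.B = s.B ∧ r.l = s.l ∧ (r.eta = s.eta ∨ r.l = r.b / 2)

/-- Rowwise equivalence of symbols. -/
def SymEquiv (E F : List Row) : Prop := List.Forall₂ Row.Equiv E F

/-- Shift of one row: `[A,B] ↦ [A+d, B+d]`. -/
def Row.sh (r : Row) (d : ℤ) : Row := { r with A := r.A + d, B := r.B + d }

/-- Add on one row: `([A,B],l) ↦ ([A+d, B-d], l+d)`. -/
def Row.addOp (r : Row) (d : ℤ) : Row :=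
  { r with A := r.A + d, B := r.B - d, l := r.l + d }

/-- `sh^d` applied to every row. -/
def shAll (d : ℤ) (E : List Row) : List Row := E.map fun r => r.sh d

/-- The updated pair of rows in a row exchange of rows `r = row k` and `s = row k+1`
(assuming one of the segments contains the other); the first component is the new row
at position `k` (the updated `s`) and the second the new row at position `k+1`
(the updated `r`). -/
def rexPair (r s : Row) : Row × Row :=
  if r.subseg s then
    -- Case `[A_k,B_k] ⊆ [A_{k+1},B_{k+1}]`
    (if m1pow (r.A - r.B) * r.eta * s.eta = 1 then
        if s.b - 2 * s.l < 2 * (r.b - 2 * r.l) then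
          (⟨s.A, s.B, s.b - (s.l + (r.b - 2 * r.l)), m1pow (r.A - r.B) * s.eta⟩ : Row)
        else ⟨s.A, s.B, s.l + (r.b - 2 * r.l), m1pow (r.A - r.B + 1) * s.eta⟩
      else ⟨s.A, s.B, s.l - (r.b - 2 * r.l), m1pow (r.A - r.B + 1) * s.eta⟩,
     ⟨r.A, r.B, r.l, m1pow (s.A - s.B) * r.eta⟩)
  else
    -- Case `[A_{k+1},B_{k+1}] ⊊ [A_k,B_k]`
    (⟨s.A, s.B, s.l, m1pow (r.A - r.B) * s.eta⟩,
     if m1pow (r.A - r.B) * r.eta * s.eta = 1 then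
        if r.b - 2 * r.l < 2 * (s.b - 2 * s.l) then
          (⟨r.A, r.B, r.b - (r.l + (s.b - 2 * s.l)), m1pow (s.A - s.B) * r.eta⟩ : Row)
        else ⟨r.A, r.B, r.l + (s.b - 2 * s.l), m1pow (s.A - s.B + 1) * r.eta⟩
      else ⟨r.A, r.B, r.l - (s.b - 2 * s.l), m1pow (s.A - s.B + 1) * r.eta⟩)

/-- Row exchange `R_k` at positions `k, k+1` (0-indexed). -/
def rex (k : ℕ) (E : List Row) : List Row :=
  match E[k]?, E[k+1]? with
  | some r, some s =>
      if r.subseg s ∨ s.subseg r then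
        E.take k ++ (rexPair r s).1 :: (rexPair r s).2 :: E.drop (k + 2)
      else E
  | _, _ => E

/-- One row exchange step. -/
def ReorderStep (E F : List Row) : Prop := ∃ k, F = rex k E

/-- Admissible reorderings: finite sequences of row exchanges. -/
def Reorder : List Row → List Row → Prop := Relation.ReflTransGen ReorderStep

/-- Coincidence up to row exchanges (in either direction) and rowwise equivalence. -/
def UpToRex (E F : List Row) : Prop :=
  ∃ G, Relation.ReflTransGen (fun X Y => ReorderStep X Y ∨ ReorderStep Y X) E G ∧
    SymEquiv G F

/-- `α_i = ∑_{j<i} (A_j + B_j + 1)`. -/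
def alphaAt (E : List Row) (i : ℕ) : ℚ := ((E.take i).map Row.a).sum

/-- `β_i = ∑_{j>i} (A_j - B_j + 1)`. -/
def betaAt (E : List Row) (i : ℕ) : ℚ := ((E.drop (i + 1)).map Row.b).sum

/-- `γ_i = ∑_{j>i} (A_j + B_j + 1)`. -/
def gammaAt (E : List Row) (i : ℕ) : ℚ := ((E.drop (i + 1)).map Row.a).sum

/-- Condition (∗) of the non-vanishing criterion. -/
def StarCond (E : List Row) : Prop :=
  ∀ i : ℕ, ∀ r : Row, E[i]? = some r →
    (IsInt r.B → 0 ≤ r.B + r.l) ∧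
    (¬ IsInt r.B → r.eta = - m1pow (alphaAt E i) → (1 / 2 : ℚ) ≤ r.B + r.l) ∧
    (¬ IsInt r.B → r.eta = m1pow (alphaAt E i) → -(1 / 2 : ℚ) ≤ r.B + r.l)

/-- Xu's non-vanishing conditions at an adjacent pair of rows `(r, s) = (row k, row k+1)`. -/
def XuPair (r s : Row) : Prop :=
  ((r.A ≤ s.A ∧ r.B ≤ s.B) →
    (m1pow (r.A - r.B) * r.eta * s.eta = 1 →
        r.B + r.l ≤ s.B + s.l ∧ r.A - r.l ≤ s.A - s.l) ∧
    (m1pow (r.A - r.B) * r.eta * s.eta = -1 → r.A - r.l < s.B + s.l)) ∧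
  ((r.subseg s ∧ ¬ s.subseg r) →
    (m1pow (r.A - r.B) * r.eta * s.eta = 1 → 0 ≤ s.l - r.l ∧ s.l - r.l ≤ s.b - r.b) ∧
    (m1pow (r.A - r.B) * r.eta * s.eta = -1 → r.b ≤ r.l + s.l)) ∧
  ((s.subseg r ∧ ¬ r.subseg s) →
    (m1pow (r.A - r.B) * r.eta * s.eta = 1 → 0 ≤ r.l - s.l ∧ r.l - s.l ≤ r.b - s.b) ∧
    (m1pow (r.A - r.B) * r.eta * s.eta = -1 → s.b ≤ r.l + s.l))

/-- Xu's non-vanishing conditions at every adjacent pair of rows. -/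
def XuAll (E : List Row) : Prop := E.Chain' XuPair

/-- The non-vanishing criterion for an extended multi-segment datum. -/
def NonVanishing (E : List Row) : Prop :=
  StarCond E ∧
    ∀ d : ℕ, (∀ r ∈ E, 0 ≤ r.B + (d : ℚ)) →
      ∀ F, Reorder (shAll d E) F → XuAll F

/-- Applicability of a union-intersection at an adjacent pair of rows. -/
def uiApplicablePair (r s : Row) : Prop :=
  r.A < s.A ∧ r.B < s.B ∧
    ((m1pow (r.A - r.B) * r.eta * s.eta = 1 ∧
        (s.A - s.l = r.A - r.l ∨ s.B + s.l = r.B + r.l)) ∨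
      (m1pow (r.A - r.B) * r.eta * s.eta = -1 ∧ s.B + s.l = r.A - r.l + 1))

instance (r s : Row) : Decidable (uiApplicablePair r s) := by
  unfold uiApplicablePair; infer_instance

/-- Type 3' of a union-intersection at an adjacent pair. -/
def uiT3 (r s : Row) : Prop :=
  r.l = 0 ∧ s.l = 0 ∧ m1pow (r.A - r.B) * r.eta * s.eta = -1

instance (r s : Row) : Decidable (uiT3 r s) := by unfold uiT3; infer_instance

/-- The pair of rows produced by a union-intersection at an adjacent applicable pair. -/
def uiPair (r s : Row) : Row × Row :=
  if m1pow (r.A - r.B) * r.eta * s.eta = 1 then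
    if s.A - s.l = r.A - r.l then
      -- Case 1
      ((⟨s.A, r.B, r.l, r.eta⟩ : Row),
       (⟨r.A, s.B, s.l - (s.A - r.A), m1pow (s.A - r.A) * s.eta⟩ : Row))
    else
      -- Case 2
      if s.A - r.A ≤ r.b - 2 * r.l then
        (⟨s.A, r.B, r.l + (s.A - r.A), r.eta⟩,
         ⟨r.A, s.B, s.l, m1pow (s.A - r.A) * s.eta⟩)
      else
        (⟨s.A, r.B, r.b - r.l, - r.eta⟩,
         ⟨r.A, s.B, s.l, m1pow (s.A - r.A) * s.eta⟩)
  else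
    -- Case 3
    if s.l ≤ r.l then
      (⟨s.A, r.B, r.l, r.eta⟩, ⟨r.A, s.B, s.l, m1pow (s.A - r.A) * s.eta⟩)
    else
      (⟨s.A, r.B, r.l, r.eta⟩, ⟨r.A, s.B, r.l, m1pow (s.A - r.A + 1) * s.eta⟩)

/-- Union-intersection at positions `k, k+1` (deleting the second new row in type 3'). -/
def uiAt (k : ℕ) (E : List Row) : List Row :=
  match E[k]?, E[k+1]? with
  | some r, some s =>
      if uiApplicablePair r s then
        if uiT3 r s then
          E.take k ++ (uiPair r s).1 :: E.drop (k + 2)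
        else
          E.take k ++ (uiPair r s).1 :: (uiPair r s).2 :: E.drop (k + 2)
      else E
  | _, _ => E

/-- Minimality: no union-intersection is applicable. -/
def MinimalP (E : List Row) : Prop :=
  ∀ F, Reorder E F → ∀ k r s, F[k]? = some r → F[k+1]? = some s →
    ¬ uiApplicablePair r s

/-- The image of a row under Atobe's dual. -/
def dualRow (E : List Row) (i : ℕ) (r : Row) : Row :=
  let α := alphaAt E i
  let β := betaAt E i
  let η₀ : ℤ := if ¬ IsInt r.B ∧ r.l = r.b / 2 then - m1pow α else r.eta
  if IsInt r.B then
    ⟨r.A, -r.B, r.l + r.B, m1pow (α + β) * η₀⟩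
  else
    ⟨r.A, -r.B, r.l + r.B + ((m1pow α * η₀ : ℤ) : ℚ) / 2, - (m1pow (α + β) * η₀)⟩

/-- Atobe's dual of a symbol whose order satisfies (P'). -/
def dual (E : List Row) : List Row :=
  (E.mapIdx fun i r => dualRow E i r).reverse

/-- Applicability of the partial dual `dual_k^+` at position `k` (0-indexed). -/
def DualPlusApplicable (E : List Row) (k : ℕ) : Prop :=
  ∃ r, E[k]? = some r ∧ r.B = 1 / 2 ∧ r.l = 0 ∧ r.eta = - m1pow (alphaAt E k) ∧
    ∀ i, i < k → ∀ s, E[i]? = some s → s.B < 1 / 2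

/-- The partial dual `dual_k^+` at position `k`. -/
def dualPlus (k : ℕ) (E : List Row) : List Row :=
  match E[k]? with
  | some rk =>
      (dual ((dual E).set (E.length - 1 - k)
          ⟨rk.A, 1 / 2, 0, - m1pow (gammaAt E k)⟩)).take k ++
        (⟨rk.A, -(1 / 2), 0, - rk.eta⟩ : Row) :: E.drop (k + 1)
  | none => E

/-- Applicability of the partial dual `dual_k^-`. -/
def DualMinusApplicable (E : List Row) (k : ℕ) : Prop :=
  DualPlusApplicable (dual E) (E.length - 1 - k)

/-- The partial dual `dual_k^-`. -/
def dualMinus (k : ℕ) (E : List Row) : List Row :=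
  dual (dualPlus (E.length - 1 - k) (dual E))

/-- Maximality: `E` is not, up to row exchanges, the result of a union-intersection
applied to a non-vanishing extended multi-segment datum. -/
def Maximal (E : List Row) : Prop :=
  ¬ ∃ (E'' F : List Row) (k : ℕ) (r s : Row), IsEMS E'' ∧ NonVanishing E'' ∧
      Reorder E'' F ∧ F[k]? = some r ∧ F[k+1]? = some s ∧ uiApplicablePair r s ∧
      UpToRex (uiAt k F) E

/-- Absolute maximality. -/
def AbsolutelyMaximal (E : List Row) : Prop := Maximal E ∧ MinimalP (dual E)

/-- The sign `(-1)^{⌊b/2⌋ + l} * eta^b` of a row. -/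
def rowSign (r : Row) : ℤ :=
  (if (⌊r.b / 2⌋ + ⌊r.l⌋) % 2 = 0 then (1 : ℤ) else -1) * r.eta ^ (⌊r.b⌋.toNat)

/-- The sign product of a symbol. -/
def signProd (E : List Row) : ℤ := (E.map rowSign).prod

/-! ### Labeled symbols: rows carry labels that travel with them under reorderings. -/

/-- A labeled row. -/
abbrev LRow := ℕ × Row

/-- The underlying list of rows of a labeled symbol. -/
def rows (L : List LRow) : List Row := L.map Prod.snd

/-- `sh_i^d`, acting on the row labeled `i`. -/
def shL (i : ℕ) (d : ℤ) (L : List LRow) : List LRow :=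
  L.map fun p => if p.1 = i then (p.1, p.2.sh d) else p

/-- `add_i^d`, acting on the row labeled `i`. -/
def addL (i : ℕ) (d : ℤ) (L : List LRow) : List LRow :=
  L.map fun p => if p.1 = i then (p.1, p.2.addOp d) else p

/-- `sh^d` on a labeled symbol. -/
def shAllL (d : ℤ) (L : List LRow) : List LRow := L.map fun p => (p.1, p.2.sh d)

/-- Row exchange at positions `k, k+1` on a labeled symbol. -/
def rexL (k : ℕ) (L : List LRow) : List LRow :=
  match L[k]?, L[k+1]? with
  | some (a, r), some (c, s) =>
      if r.subseg s ∨ s.subseg r then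
        L.take k ++ (c, (rexPair r s).1) :: (a, (rexPair r s).2) :: L.drop (k + 2)
      else L
  | _, _ => L

/-- One row exchange step on labeled symbols. -/
def ReorderStepL (L M : List LRow) : Prop := ∃ k, M = rexL k L

/-- Admissible reorderings of labeled symbols. -/
def ReorderL : List LRow → List LRow → Prop := Relation.ReflTransGen ReorderStepL

/-- Labelwise equivalence of labeled symbols. -/
def LSymEquiv (L M : List LRow) : Prop :=
  List.Forall₂ (fun p q => p.1 = q.1 ∧ Row.Equiv p.2 q.2) L M

/-- `M` coincides with `L` up to row exchanges and rowwise equivalence (labels forgotten). -/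
def CoincidesUpToRex (L M : List LRow) : Prop :=
  ∃ L', Relation.ReflTransGen (fun X Y => ReorderStepL X Y ∨ ReorderStepL Y X) L L' ∧
    SymEquiv (rows L') (rows M)

/-- Union-intersection at positions `k, k+1` on a labeled symbol. -/
def uiAtL (k : ℕ) (L : List LRow) : List LRow :=
  match L[k]?, L[k+1]? with
  | some (a, r), some (c, s) =>
      if uiApplicablePair r s then
        if uiT3 r s then
          L.take k ++ (a, (uiPair r s).1) :: L.drop (k + 2)
        else
          L.take k ++ (a, (uiPair r s).1) :: (c, (uiPair r s).2) :: L.drop (k + 2)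
      else L
  | _, _ => L

/-- The relation `M = ui_{i,j}(L)`, with a constraint `P` on the adjacent pair used:
some admissible reordering `L'` of `L` puts the row labeled `i` immediately before the
row labeled `j`, `ui` is applicable there, and `M` is obtained from the result by row
exchanges restoring the original relative order of the (surviving) labels. -/
def UIrelWith (P : Row → Row → Prop) (L : List LRow) (i j : ℕ) (M : List LRow) : Prop :=
  ∃ (L' : List LRow) (k : ℕ) (r s : Row),
    ReorderL L L' ∧ L'[k]? = some (i, r) ∧ L'[k+1]? = some (j, s) ∧
    uiApplicablePair r s ∧ P r s ∧
    ReorderL (uiAtL k L') M ∧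
    M.map Prod.fst =
      (L.map Prod.fst).filter fun x => decide (x ∈ (uiAtL k L').map Prod.fst)

/-- The relation `M = ui_{i,j}(L)`. -/
def UIrel (L : List LRow) (i j : ℕ) (M : List LRow) : Prop :=
  UIrelWith (fun _ _ => True) L i j M

/-- Atobe's dual of a labeled symbol. -/
def dualL (L : List LRow) : List LRow :=
  (L.mapIdx fun i p => (p.1, dualRow (rows L) i p.2)).reverse

/-- The partial dual `dual^+` at position `k` on a labeled symbol. -/
def dualPlusL (k : ℕ) (L : List LRow) : List LRow :=
  match L[k]? with
  | some (lab, rk) =>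
      (dualL ((dualL L).set (L.length - 1 - k)
          (lab, ⟨rk.A, 1 / 2, 0, - m1pow (gammaAt (rows L) k)⟩))).take k ++
        (lab, (⟨rk.A, -(1 / 2), 0, - rk.eta⟩ : Row)) :: L.drop (k + 1)
  | none => L

/-- Position of the row labeled `i`. -/
def posOf (L : List LRow) (i : ℕ) : ℕ := L.findIdx fun p => p.1 == i

/-- The partial dual `dual_i^+`, acting at the row labeled `i`. -/
def dualPlusLab (i : ℕ) (L : List LRow) : List LRow := dualPlusL (posOf L i) L

/-- Applicability of `dual_i^+` on a labeled symbol. -/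
def DualPlusApplicableLab (i : ℕ) (L : List LRow) : Prop :=
  i ∈ L.map Prod.fst ∧ DualPlusApplicable (rows L) (posOf L i)

/-- The partial dual `dual_i^-` on a labeled symbol. -/
def dualMinusLab (i : ℕ) (L : List LRow) : List LRow := dualL (dualPlusLab i (dualL L))

/-- Applicability of `dual_i^-` on a labeled symbol. -/
def DualMinusApplicableLab (i : ℕ) (L : List LRow) : Prop :=
  DualPlusApplicableLab i (dualL L)

/-- One basic operator step: a row exchange, a union-intersection, a composition
`dual ∘ ui_{i,j} ∘ dual`, or an inverse of one of these. -/
def BasicStep (L M : List LRow) : Prop :=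
  (∃ k, M = rexL k L) ∨ (∃ k, L = rexL k M) ∨
  (∃ i j, UIrel L i j M) ∨ (∃ i j, UIrel M i j L) ∨
  (∃ i j N, UIrel (dualL L) i j N ∧ M = dualL N) ∨
  (∃ i j N, UIrel (dualL M) i j N ∧ L = dualL N)

/-- Finite sequences of basic operators. -/
def Basic : List LRow → List LRow → Prop := Relation.ReflTransGen BasicStep

/-- Shift every row after position `j` one step to the right. -/
def shAfter (j : ℕ) (E : List Row) : List Row :=
  E.mapIdx fun i r => if j < i then r.sh 1 else r

/-- Shift every row with `B_i ≥ B` one step to the left. -/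
def shiftGE (B : ℚ) (E : List Row) : List Row :=
  E.map fun r => if B ≤ r.B then r.sh (-1) else r

/-- Shift every row with `B_i ≥ 1/2` one step to the left, deleting the rows of the
form `([1/2,1/2], 0, η)`. -/
def shiftHalfDel (E : List Row) : List Row :=
  (E.filter fun r => !decide (r.A = 1 / 2 ∧ r.B = 1 / 2 ∧ r.l = 0)).map
    fun r => if (1 / 2 : ℚ) ≤ r.B then r.sh (-1) else r

/-- The rows `([A-r, -(A-r)-1], ⌊A⌋-r, 1)` for `r = 0, …, ⌊A⌋`. -/
def prefixRows (A : ℚ) : List Row :=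
  (List.range (⌊A⌋.toNat + 1)).map fun r =>
    ⟨A - r, -(A - r) - 1, (⌊A⌋ : ℚ) - r, 1⟩

theorem add_intCast_num (x : ℚ) (d : ℤ) : (x + d).num = x.num + d * x.den := by
  have h : ((x + d).num : ℚ) = x.num + d * x.den := by
    rw [← Rat.mul_den_eq_num (x + d), ← Rat.mul_den_eq_num x, Rat.add_intCast_den]
    ring
  exact_mod_cast h

theorem isInt_add_intCast (x : ℚ) (d : ℤ) : IsInt (x + d) ↔ IsInt x := by
  rw [IsInt, IsInt, Rat.add_intCast_den]

theorem m1pow_add_two_mul_intCast (x : ℚ) (d : ℤ) : m1pow (x + 2 * d) = m1pow x := by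
  have h : (x + 2 * d).num = x.num + 2 * (d * x.den) := by
    have h := add_intCast_num x (2 * d)
    push_cast at h
    rw [h, mul_assoc]
  rw [m1pow, m1pow, h, Int.add_mul_emod_self_left]

theorem Row.sh_b (r : Row) (d : ℤ) : (r.sh d).b = r.b := by
  simp [Row.sh, Row.b]

theorem betaAt_rows_shL (k : ℕ) (t : ℤ) (L : List LRow) (i : ℕ) :
    betaAt (rows (shL k t L)) i = betaAt (rows L) i := by
  have h : (rows (shL k t L)).map Row.b = (rows L).map Row.b := by
    simp only [rows, shL, List.map_map]
    refine List.map_congr_left fun p _ => ?_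
    simp only [Function.comp_apply]
    split_ifs <;> simp [Row.sh_b]
  rw [betaAt, betaAt, List.map_drop, List.map_drop, h]

theorem alphaAt_cons_succ (r : Row) (E : List Row) (i : ℕ) :
    alphaAt (r :: E) (i + 1) = r.a + alphaAt E i := by
  simp [alphaAt]

/-- Shifting a row changes `α_i` by an even integer. -/
theorem exists_alphaAt_rows_shL (k : ℕ) (t : ℤ) (L : List LRow) (i : ℕ) :
    ∃ m : ℤ, alphaAt (rows (shL k t L)) i = alphaAt (rows L) i + 2 * m := by
  induction L generalizing i with
  | nil => exact ⟨0, by simp [rows, shL]⟩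
  | cons p L ih =>
    cases i with
    | zero => exact ⟨0, by simp [alphaAt]⟩
    | succ i =>
      obtain ⟨m, hm⟩ := ih i
      simp only [rows, shL] at hm
      simp only [rows, shL, List.map_cons, alphaAt_cons_succ, hm]
      split_ifs
      · refine ⟨m + t, ?_⟩
        simp only [Row.sh, Row.a]
        push_cast
        ring
      · exact ⟨m, by ring⟩

/-- The dual of a row depends on the other rows only through the parity of `α_i` and `β_i`. -/
theorem dualRow_congr {E F : List Row} {i : ℕ} {m : ℤ}
    (hα : alphaAt E i = alphaAt F i + 2 * m) (hβ : betaAt E i = betaAt F i) (r : Row) :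
    dualRow E i r = dualRow F i r := by
  simp only [dualRow, hα, hβ, m1pow_add_two_mul_intCast, add_right_comm _ (2 * (m : ℚ))]

theorem dualRow_sh (E : List Row) (i : ℕ) (r : Row) (t : ℤ) :
    dualRow E i (r.sh t) = (dualRow E i r).addOp t := by
  simp only [dualRow, Row.sh_b]
  simp only [Row.sh, isInt_add_intCast]
  split_ifs <;> simp only [Row.addOp, Row.mk.injEq, true_and, and_true] <;>
    constructor <;> ring

theorem dualL_shL (k : ℕ) (t : ℤ) (L : List LRow) :
    dualL (shL k t L) = addL k t (dualL L) := by
  rw [dualL, dualL, addL, List.map_reverse]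
  congr 1
  refine List.ext_getElem (by simp [shL]) fun i h₁ h₂ => ?_
  obtain ⟨m, hm⟩ := exists_alphaAt_rows_shL k t L i
  simp only [List.getElem_mapIdx, List.getElem_map,
    dualRow_congr hm (betaAt_rows_shL k t L i)]
  simp only [shL, List.getElem_map]
  split_ifs <;> simp [dualRow_sh]

theorem Row.Equiv.refl (r : Row) : r.Equiv r :=
  ⟨rfl, rfl, rfl, Or.inl rfl⟩

/-- Lemma 3.13(ii): `dual(sh_k^t(E)) = add_k^t(dual(E))` whenever all admissible
reorderings of `sh_k^t(E)` satisfy (P') (rows labeled `0, …, n-1` in the listed order). -/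
theorem dual_sh_eq_add_dual (L : List LRow)
    (hlab : L.map Prod.fst = List.range L.length)
    (hE : IsEMS (rows L)) (hP : Pprime (rows L))
    (k : ℕ) (hk : k < L.length) (t : ℤ)
    (hsym : IsSymbol (rows (shL k t L)))
    (hall : ∀ M, ReorderL (shL k t L) M → Pprime (rows M)) :
    LSymEquiv (dualL (shL k t L)) (addL k t (dualL L)) := by
  rw [dualL_shL]
  exact List.forall₂_same.mpr fun p _ => ⟨rfl, Row.Equiv.refl p.2⟩

end LocalArthur
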